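/- Let d₁, d₂ ≥ 1, let f : ℝ^{d₁} × ℝ^{d₂} → ℝ be continuously differentiable, let g : ℝ^{d₁} × ℝ^{d₂} → ℝ be twice continuously differentiable, and let λ : ℝ^{d₁} → ℝ^{d₂} be differentiable with ∇_β g(α, λ(α)) = 0 and ∇²_{ββ}g(α, λ(α)) invertible for every α ∈ ℝ^{d₁}. Set F(α) := f(α, λ(α)) and let ∇̄f denote the surrogate gradient. If ᾱ : I → ℝ^{d₁} is differentiable on an interval I with ᾱ'(t) = −∇̄f(ᾱ(t), λ(ᾱ(t))) for all t ∈ I, then the function t ↦ F(ᾱ(t)) is differentiable on I with derivative −‖∇F(ᾱ(t))‖² ≤ 0 for all t ∈ I; in particular t ↦ F(ᾱ(t)) is nonincreasing, and is strictly decreasing on any subinterval on which ∇F(ᾱ(t)) ≠ 0. -/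

import Mathlib

/-- The gradient of `g` in its second variable: `∇_β g(α, β)`. -/
noncomputable def gradSnd {d₁ d₂ : ℕ}
    (g : EuclideanSpace ℝ (Fin d₁) × EuclideanSpace ℝ (Fin d₂) → ℝ)
    (α : EuclideanSpace ℝ (Fin d₁)) (β : EuclideanSpace ℝ (Fin d₂)) :
    EuclideanSpace ℝ (Fin d₂) :=
  gradient (fun β' => g (α, β')) β

/-- The surrogate gradient `∇̄f(α, λ(α))` of `f` relative to `g`, evaluated along the
lower-level solution map `lam`, where `Jinv α` is the inverse of the partial Hessian
`∇²_{ββ} g(α, lam α)`. -/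
noncomputable def surrogateGradAt {d₁ d₂ : ℕ}
    (f g : EuclideanSpace ℝ (Fin d₁) × EuclideanSpace ℝ (Fin d₂) → ℝ)
    (lam : EuclideanSpace ℝ (Fin d₁) → EuclideanSpace ℝ (Fin d₂))
    (Jinv : EuclideanSpace ℝ (Fin d₁) →
      (EuclideanSpace ℝ (Fin d₂) ≃L[ℝ] EuclideanSpace ℝ (Fin d₂)))
    (α : EuclideanSpace ℝ (Fin d₁)) : EuclideanSpace ℝ (Fin d₁) :=
  gradient (fun a => f (a, lam α)) α -
    (ContinuousLinearMap.adjoint (fderiv ℝ (fun a => gradSnd g a (lam α)) α))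
      ((Jinv α).symm (gradient (fun β => f (α, β)) (lam α)))

open ContinuousLinearMap

section Gradient

variable {H : Type*} [NormedAddCommGroup H] [InnerProductSpace ℝ H] [CompleteSpace H]

/-- The Hessian of a twice continuously differentiable function is symmetric. -/
theorem inner_fderiv_gradient_comm {h : H → ℝ} (hh : ContDiff ℝ 2 h) (x v w : H) :
    inner ℝ (fderiv ℝ (gradient h) x v) w = inner ℝ v (fderiv ℝ (gradient h) x w) := by
  have hd : DifferentiableAt ℝ (fderiv ℝ h) x :=
    (hh.fderiv_right (m := 1) (by norm_num)).differentiable (by norm_num) x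
  have key (u : H) : fderiv ℝ (gradient h) x u =
      (InnerProductSpace.toDual ℝ H).symm (fderiv ℝ (fderiv ℝ h) x u) := by
    have := ((InnerProductSpace.toDual ℝ H).symm.toContinuousLinearEquiv.toContinuousLinearMap
      |>.restrictScalars ℝ).hasFDerivAt.comp x hd.hasFDerivAt
    exact congrArg (fun L => L u) this.fderiv
  have hs : IsSymmSndFDerivAt ℝ h x := hh.contDiffAt.isSymmSndFDerivAt (by simp)
  rw [key, key, real_inner_comm _ v, InnerProductSpace.toDual_symm_apply,
    InnerProductSpace.toDual_symm_apply]
  exact hs v w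

end Gradient

section PartialGradient

variable {d₁ d₂ : ℕ} {f g : EuclideanSpace ℝ (Fin d₁) × EuclideanSpace ℝ (Fin d₂) → ℝ}
  {lam : EuclideanSpace ℝ (Fin d₁) → EuclideanSpace ℝ (Fin d₂)}

theorem differentiable_gradSnd (hg : ContDiff ℝ 2 g) :
    Differentiable ℝ (fun p : EuclideanSpace ℝ (Fin d₁) × EuclideanSpace ℝ (Fin d₂) =>
      gradSnd g p.1 p.2) := by
  have h : ContDiff ℝ 1 (fun p : EuclideanSpace ℝ (Fin d₁) × EuclideanSpace ℝ (Fin d₂) =>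
      fderiv ℝ (fun β => g (p.1, β)) p.2) :=
    ContDiff.fderiv (m := 2)
      (f := fun (p : EuclideanSpace ℝ (Fin d₁) × EuclideanSpace ℝ (Fin d₂)) β => g (p.1, β))
      (by fun_prop) contDiff_snd (by norm_num)
  exact (InnerProductSpace.toDual ℝ _).symm.differentiable.comp (h.differentiable (by norm_num))

/-- Chain rule along a graph, with the derivative split into its partial derivatives. -/
theorem hasFDerivAt_comp_graph {V E H : Type*} [NormedAddCommGroup V] [NormedSpace ℝ V]
    [NormedAddCommGroup E] [NormedSpace ℝ E] [NormedAddCommGroup H] [NormedSpace ℝ H]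
    {φ : E × H → V} {l : E → H} {x : E}
    (hφ : DifferentiableAt ℝ φ (x, l x)) (hl : DifferentiableAt ℝ l x) :
    HasFDerivAt (fun a => φ (a, l a))
      (fderiv ℝ (fun a => φ (a, l x)) x + (fderiv ℝ (fun b => φ (x, b)) (l x)).comp (fderiv ℝ l x))
      x := by
  have h₁ := (HasFDerivAt.comp (f := fun a => (a, l x)) x hφ.hasFDerivAt (hasFDerivAt_prodMk_left x (l x))).fderiv
  have h₂ := (HasFDerivAt.comp (f := fun b => (x, b)) (l x) hφ.hasFDerivAt
    (hasFDerivAt_prodMk_right x (l x))).fderiv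
  have h := HasFDerivAt.comp (f := fun a => (a, l a)) x hφ.hasFDerivAt
    ((hasFDerivAt_id x).prodMk hl.hasFDerivAt)
  simp only [Function.comp_def] at h₁ h₂ h
  rw [h₁, h₂]
  refine h.congr_fderiv ?_
  ext v
  simp [← map_add]

/-- Along the solution map of the lower-level problem, the surrogate gradient is the gradient of
the reduced objective. -/
theorem surrogateGradAt_eq_gradient (hf : Differentiable ℝ f) (hg : ContDiff ℝ 2 g)
    (hlam : Differentiable ℝ lam) (hfoc : ∀ α, gradSnd g α (lam α) = 0)
    {Jinv : EuclideanSpace ℝ (Fin d₁) →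
      (EuclideanSpace ℝ (Fin d₂) ≃L[ℝ] EuclideanSpace ℝ (Fin d₂))}
    (hJinv : ∀ α, ((Jinv α) : EuclideanSpace ℝ (Fin d₂) →L[ℝ] EuclideanSpace ℝ (Fin d₂)) =
      fderiv ℝ (fun β => gradSnd g α β) (lam α)) (α : EuclideanSpace ℝ (Fin d₁)) :
    surrogateGradAt f g lam Jinv α = gradient (fun α => f (α, lam α)) α := by
  have hsymm (v w : EuclideanSpace ℝ (Fin d₂)) :
      inner ℝ ((Jinv α).symm v) w = inner ℝ v ((Jinv α).symm w) := by
    have h := inner_fderiv_gradient_comm (h := fun β => g (α, β)) (by fun_prop) (lam α)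
      ((Jinv α).symm v) ((Jinv α).symm w)
    have hJ (u) : fderiv ℝ (gradient fun β => g (α, β)) (lam α) u = Jinv α u :=
      (congrArg (fun L => L u) (hJinv α)).symm
    rw [hJ, hJ] at h
    simpa using h.symm
  refine ext_inner_right ℝ fun v => ?_
  have hF := hasFDerivAt_comp_graph (hf (α, lam α)) (hlam α)
  have hG := hasFDerivAt_comp_graph (differentiable_gradSnd hg (α, lam α)) (hlam α)
  simp only [hfoc, ← hJinv] at hG
  have hv : fderiv ℝ (fun a => gradSnd g a (lam α)) α v + Jinv α (fderiv ℝ lam α v) = 0 :=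
    congrArg (fun L => L v) (hG.unique (hasFDerivAt_const _ α))
  have hl : (Jinv α).symm (fderiv ℝ (fun a => gradSnd g a (lam α)) α v) = -fderiv ℝ lam α v := by
    rw [eq_neg_of_add_eq_zero_left hv, map_neg, ContinuousLinearEquiv.symm_apply_apply]
  rw [surrogateGradAt, inner_sub_left, adjoint_inner_left, hsymm, hl, inner_neg_right,
    inner_gradient_left, inner_gradient_left, inner_gradient_left,
    hF.fderiv]
  simp

end PartialGradient

theorem stmt8 {d₁ d₂ : ℕ} (hd₁ : 1 ≤ d₁) (hd₂ : 1 ≤ d₂)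
    (f : EuclideanSpace ℝ (Fin d₁) × EuclideanSpace ℝ (Fin d₂) → ℝ)
    (hf : ContDiff ℝ 1 f)
    (g : EuclideanSpace ℝ (Fin d₁) × EuclideanSpace ℝ (Fin d₂) → ℝ)
    (hg : ContDiff ℝ 2 g)
    (lam : EuclideanSpace ℝ (Fin d₁) → EuclideanSpace ℝ (Fin d₂))
    (hlam : Differentiable ℝ lam)
    (hfoc : ∀ α, gradSnd g α (lam α) = 0)
    (Jinv : EuclideanSpace ℝ (Fin d₁) →
      (EuclideanSpace ℝ (Fin d₂) ≃L[ℝ] EuclideanSpace ℝ (Fin d₂)))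
    (hJinv : ∀ α, ((Jinv α) : EuclideanSpace ℝ (Fin d₂) →L[ℝ] EuclideanSpace ℝ (Fin d₂)) =
      fderiv ℝ (fun β => gradSnd g α β) (lam α))
    (I : Set ℝ) (hI : I.OrdConnected)
    (abar : ℝ → EuclideanSpace ℝ (Fin d₁))
    (habar : ∀ t ∈ I, HasDerivAt abar (-(surrogateGradAt f g lam Jinv (abar t))) t) :
    (∀ t ∈ I, HasDerivAt (fun u => f (abar u, lam (abar u)))
      (-‖gradient (fun α => f (α, lam α)) (abar t)‖ ^ 2) t) ∧
    AntitoneOn (fun t => f (abar t, lam (abar t))) I ∧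
    (∀ t₁ ∈ I, ∀ t₂ ∈ I, t₁ < t₂ →
      (∀ t ∈ Set.Icc t₁ t₂, gradient (fun α => f (α, lam α)) (abar t) ≠ 0) →
      f (abar t₂, lam (abar t₂)) < f (abar t₁, lam (abar t₁))) := by
  have hfd : Differentiable ℝ f := hf.differentiable (by norm_num)
  have hderiv : ∀ t ∈ I, HasDerivAt (fun u => f (abar u, lam (abar u)))
      (-‖gradient (fun α => f (α, lam α)) (abar t)‖ ^ 2) t := by
    intro t ht
    have hF : DifferentiableAt ℝ (fun α => f (α, lam α)) (abar t) := by fun_prop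
    have h := hF.hasFDerivAt.comp_hasDerivAt t (habar t ht)
    rwa [surrogateGradAt_eq_gradient hfd hg hlam hfoc hJinv, ← inner_gradient_left,
      inner_neg_right, real_inner_self_eq_norm_sq] at h
  refine ⟨hderiv, ?_, fun t₁ ht₁ t₂ ht₂ hlt hne => ?_⟩
  · refine antitoneOn_of_deriv_nonpos hI.convex
      (fun t ht => (hderiv t ht).continuousAt.continuousWithinAt)
      (fun t ht => (hderiv t (interior_subset ht)).differentiableAt.differentiableWithinAt)
      (fun t ht => ?_)
    rw [(hderiv t (interior_subset ht)).deriv]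
    exact neg_nonpos.2 (sq_nonneg _)
  · have hsub : Set.Icc t₁ t₂ ⊆ I := hI.out ht₁ ht₂
    refine strictAntiOn_of_deriv_neg (convex_Icc t₁ t₂)
      (fun t ht => (hderiv t (hsub ht)).continuousAt.continuousWithinAt) (fun t ht => ?_)
      (Set.left_mem_Icc.2 hlt.le) (Set.right_mem_Icc.2 hlt.le) hlt
    rw [(hderiv t (hsub (interior_subset ht))).deriv]
    exact neg_lt_zero.2 (pow_pos (norm_pos_iff.2 (hne t (interior_subset ht))) 2)
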